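/- The elementary deformation preserves the ranks of the intersections and their projections: dim_ℂ(L₁ ∩ L₂') = dim_ℂ(L₁ ∩ L₂), dim_ℂ(L₁ ∩ conj(L₂')) = dim_ℂ(L₁ ∩ conj(L₂)), dim_ℂ pr_T(L₁ ∩ L₂') = dim_ℂ pr_T(L₁ ∩ L₂), and dim_ℂ pr_T(L₁ ∩ conj(L₂')) = dim_ℂ pr_T(L₁ ∩ conj(L₂)). -/

import Mathlib

open Module TensorProduct

/-- The generalized tangent space `W = V ⊕ V*`. -/
abbrev GT (V : Type*) [AddCommGroup V] [Module ℝ V] := V × Module.Dual ℝ V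

/-- The canonical symmetric pairing `⟨X+ξ, Y+η⟩ = (1/2)(η(X) + ξ(Y))` on `W = V ⊕ V*`,
as a bilinear form. -/
noncomputable def gpairB (V : Type*) [AddCommGroup V] [Module ℝ V] :
    LinearMap.BilinForm ℝ (GT V) :=
  (1 / 2 : ℝ) •
    ((LinearMap.id : Module.Dual ℝ V →ₗ[ℝ] Module.Dual ℝ V).compl₁₂
        (LinearMap.snd ℝ V (Module.Dual ℝ V)) (LinearMap.fst ℝ V (Module.Dual ℝ V)) +
      ((LinearMap.id : Module.Dual ℝ V →ₗ[ℝ] Module.Dual ℝ V).compl₁₂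
        (LinearMap.snd ℝ V (Module.Dual ℝ V)) (LinearMap.fst ℝ V (Module.Dual ℝ V))).flip)

/-- A generalized almost complex structure on `V`. -/
def IsGacs {V : Type*} [AddCommGroup V] [Module ℝ V] (J : GT V →ₗ[ℝ] GT V) : Prop :=
  (∀ u, J (J u) = -u) ∧ (∀ u v, gpairB V (J u) v = - gpairB V u (J v))

/-- A generalized almost Hermitian structure on `V`. -/
structure IsGah {V : Type*} [AddCommGroup V] [Module ℝ V]
    (G : GT V →ₗ[ℝ] GT V →ₗ[ℝ] ℝ) (J Gend : GT V →ₗ[ℝ] GT V) : Prop where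
  gacs : IsGacs J
  symm : ∀ u v, G u v = G v u
  posdef : ∀ u, u ≠ 0 → 0 < G u u
  hermitian : ∀ u v, G (J u) (J v) = G u v
  gend_pair : ∀ u v, G u v = gpairB V (Gend u) v
  gend_sq : ∀ u, Gend (Gend u) = u

instance : RingHomSurjective (starRingEnd ℂ) := ⟨fun x => ⟨star x, by simp⟩⟩

/-- Complex conjugation on the complexification `ℂ ⊗ M` of a real module. -/
noncomputable def conjC (M : Type*) [AddCommGroup M] [Module ℝ M] :
    (ℂ ⊗[ℝ] M) →ₛₗ[starRingEnd ℂ] (ℂ ⊗[ℝ] M) where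
  toFun := LinearMap.rTensor M Complex.conjAe.toLinearMap
  map_add' x y := map_add _ x y
  map_smul' c x := by
    show LinearMap.rTensor M Complex.conjAe.toLinearMap (c • x) =
      (starRingEnd ℂ) c • LinearMap.rTensor M Complex.conjAe.toLinearMap x
    induction x using TensorProduct.induction_on with
    | zero => simp
    | tmul a m =>
        rw [smul_tmul', LinearMap.rTensor_tmul, LinearMap.rTensor_tmul, smul_tmul']
        congr 1
        simp [Complex.conjAe]
    | add x y hx hy =>
        rw [smul_add, map_add, hx, hy, map_add, smul_add]

/-- The `(1,0)`-space (`i`-eigenspace) of the complexification of an endomorphism of `W`. -/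
noncomputable def iEigen {V : Type*} [AddCommGroup V] [Module ℝ V]
    (J : GT V →ₗ[ℝ] GT V) : Submodule ℂ (ℂ ⊗[ℝ] GT V) :=
  @Module.End.eigenspace ℂ (ℂ ⊗[ℝ] GT V) _ _ _ (J.baseChange ℂ) Complex.I

/-- The projection `pr_T : W_ℂ → V_ℂ`. -/
noncomputable def prTc (V : Type*) [AddCommGroup V] [Module ℝ V] :
    (ℂ ⊗[ℝ] GT V) →ₗ[ℂ] ℂ ⊗[ℝ] V :=
  (LinearMap.fst ℝ V (Module.Dual ℝ V)).baseChange ℂ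

section Complexification

variable {M N P : Type*} [AddCommGroup M] [Module ℝ M] [AddCommGroup N] [Module ℝ N]
  [AddCommGroup P] [Module ℝ P]

theorem conjC_tmul (z : ℂ) (m : M) : conjC M (z ⊗ₜ m) = (starRingEnd ℂ z) ⊗ₜ m := rfl

theorem conjC_conjC (x : ℂ ⊗[ℝ] M) : conjC M (conjC M x) = x := by
  induction x using TensorProduct.induction_on with
  | zero => simp
  | tmul z m => simp [conjC_tmul]
  | add x y hx hy => rw [map_add, map_add, hx, hy]

theorem baseChange_conjC (A : M →ₗ[ℝ] N) (x : ℂ ⊗[ℝ] M) :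
    A.baseChange ℂ (conjC M x) = conjC N (A.baseChange ℂ x) := by
  induction x using TensorProduct.induction_on with
  | zero => simp
  | tmul z m => simp [conjC_tmul]
  | add x y hx hy => rw [map_add, map_add, hx, hy, map_add, map_add]

/-- Two real linear maps without common kernel have no common kernel after complexification. -/
theorem eq_zero_of_baseChange_eq_zero {A : M →ₗ[ℝ] N} {B : M →ₗ[ℝ] P}
    (h : ∀ m, A m = 0 → B m = 0 → m = 0) {x : ℂ ⊗[ℝ] M}
    (hA : A.baseChange ℂ x = 0) (hB : B.baseChange ℂ x = 0) : x = 0 := by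
  have hinj : Function.Injective (LinearMap.inl ℝ N P ∘ₗ A + LinearMap.inr ℝ N P ∘ₗ B) := by
    refine (injective_iff_map_eq_zero _).2 fun m hm => ?_
    have hm' : A m = 0 ∧ B m = 0 := by simpa using hm
    exact h m hm'.1 hm'.2
  have hinjC := Module.Flat.lTensor_preserves_injective_linearMap (M := ℂ) _ hinj
  refine (injective_iff_map_eq_zero _).1 hinjC x ?_
  change LinearMap.baseChange ℂ _ x = 0
  rw [LinearMap.baseChange_add, LinearMap.baseChange_comp, LinearMap.baseChange_comp]
  simp [hA, hB]

end Complexification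

theorem rank_map_of_forall_eq_zero.{u, v} {K : Type v} [Field K] {E F : Type u} [AddCommGroup E]
    [Module K E] [AddCommGroup F] [Module K F] (p : E →ₗ[K] F) (U : Submodule K E)
    (h : ∀ x ∈ U, p x = 0 → x = 0) : Module.rank K (U.map p) = Module.rank K U := by
  have hinj : Function.Injective (p.domRestrict U) :=
    (injective_iff_map_eq_zero _).2 fun x hx => Subtype.ext (h x x.2 hx)
  rw [← LinearMap.range_domRestrict, rank_range_of_injective _ hinj]

section Eigenspaces

variable {V : Type*} [AddCommGroup V] [Module ℝ V]

/-- The `μ`-eigenspace of the complexification of an endomorphism of `W`. -/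
noncomputable def cEigen (A : GT V →ₗ[ℝ] GT V) (μ : ℂ) : Submodule ℂ (ℂ ⊗[ℝ] GT V) :=
  @Module.End.eigenspace ℂ (ℂ ⊗[ℝ] GT V) _ _ _ (A.baseChange ℂ) μ

theorem mem_cEigen {A : GT V →ₗ[ℝ] GT V} {μ : ℂ} {x : ℂ ⊗[ℝ] GT V} :
    x ∈ cEigen A μ ↔ A.baseChange ℂ x = μ • x :=
  Module.End.mem_eigenspace_iff

theorem iEigen_eq_cEigen (A : GT V →ₗ[ℝ] GT V) : iEigen A = cEigen A Complex.I := rfl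

theorem map_conjC_iEigen (A : GT V →ₗ[ℝ] GT V) :
    (iEigen A).map (conjC (GT V)) = cEigen A (-Complex.I) := by
  ext x
  rw [mem_cEigen, iEigen_eq_cEigen]
  constructor
  · rintro ⟨y, hy, rfl⟩
    rw [baseChange_conjC, mem_cEigen.1 hy, LinearMap.map_smulₛₗ, Complex.conj_I]
  · intro hx
    refine ⟨conjC (GT V) x, mem_cEigen.2 ?_, conjC_conjC x⟩
    rw [baseChange_conjC, hx, LinearMap.map_smulₛₗ, map_neg, Complex.conj_I, neg_neg]

theorem baseChange_comp_conj (τ : GT V ≃ₗ[ℝ] GT V) (A B : GT V →ₗ[ℝ] GT V)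
    (h : ∀ u, τ (A u) = B (τ u)) (x : ℂ ⊗[ℝ] GT V) :
    B.baseChange ℂ (τ.toLinearMap.baseChange ℂ x)
      = τ.toLinearMap.baseChange ℂ (A.baseChange ℂ x) := by
  have h' : B ∘ₗ τ.toLinearMap = τ.toLinearMap ∘ₗ A := LinearMap.ext fun u => (h u).symm
  rw [← LinearMap.comp_apply, ← LinearMap.comp_apply, ← LinearMap.baseChange_comp,
    ← LinearMap.baseChange_comp, h']

theorem map_cEigen (τ : GT V ≃ₗ[ℝ] GT V) {A B : GT V →ₗ[ℝ] GT V}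
    (h : ∀ u, τ (A u) = B (τ u)) (μ : ℂ) :
    (cEigen A μ).map (τ.baseChange ℝ ℂ _ _).toLinearMap = cEigen B μ := by
  ext x
  obtain ⟨y, rfl⟩ := (τ.baseChange ℝ ℂ _ _).surjective x
  have key : B.baseChange ℂ (τ.baseChange ℝ ℂ _ _ y)
      = τ.baseChange ℝ ℂ _ _ (A.baseChange ℂ y) := baseChange_comp_conj τ A B h y
  rw [mem_cEigen, key, ← map_smul, EmbeddingLike.apply_eq_iff_eq, ← mem_cEigen]
  rw [Submodule.mem_map_equiv, LinearEquiv.symm_apply_apply]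

/-- An automorphism commuting with `A` carries joint eigenspaces of `A` and `B` to joint
eigenspaces of `A` and the conjugate of `B`. -/
theorem rank_cEigen_inf_cEigen (τ : GT V ≃ₗ[ℝ] GT V) {A B B' : GT V →ₗ[ℝ] GT V}
    (hA : ∀ u, τ (A u) = A (τ u)) (hB : ∀ u, τ (B u) = B' (τ u)) (μ ν : ℂ) :
    Module.rank ℂ ↥(cEigen A μ ⊓ cEigen B' ν) = Module.rank ℂ ↥(cEigen A μ ⊓ cEigen B ν) := by
  have key : (cEigen A μ ⊓ cEigen B ν).map (τ.baseChange ℝ ℂ _ _).toLinearMap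
      = cEigen A μ ⊓ cEigen B' ν := by
    rw [Submodule.map_inf _ (LinearEquiv.injective _), map_cEigen τ hA, map_cEigen τ hB]
  rw [← key]
  exact LinearEquiv.rank_map_eq _ _

theorem gpairB_apply (u v : GT V) : gpairB V u v = (1 / 2) * (u.2 v.1 + v.2 u.1) := by
  simp [gpairB, mul_add]

theorem gpairB_comm (u v : GT V) : gpairB V u v = gpairB V v u := by
  rw [gpairB_apply, gpairB_apply, add_comm]

end Eigenspaces

namespace IsGah

variable {V : Type*} [AddCommGroup V] [Module ℝ V] {G : GT V →ₗ[ℝ] GT V →ₗ[ℝ] ℝ}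
  {J Gend : GT V →ₗ[ℝ] GT V}

theorem gend_gend_pair (h : IsGah G J Gend) (u v : GT V) :
    gpairB V (Gend u) (Gend v) = gpairB V u v := by
  rw [← h.gend_pair, h.symm, h.gend_pair, h.gend_sq, gpairB_comm]

theorem j_j_pair (h : IsGah G J Gend) (u v : GT V) :
    gpairB V (J u) (J v) = gpairB V u v := by
  rw [h.gacs.2, h.gacs.1, map_neg, neg_neg]

theorem gpairB_nondeg (h : IsGah G J Gend) {u : GT V} (hu : ∀ v, gpairB V u v = 0) : u = 0 := by
  by_contra h0
  have := h.posdef u h0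
  rw [h.symm, h.gend_pair, gpairB_comm, hu] at this
  exact lt_irrefl _ this

theorem gend_comm (h : IsGah G J Gend) (u : GT V) : Gend (J u) = J (Gend u) := by
  rw [← sub_eq_zero]
  refine h.gpairB_nondeg fun v => ?_
  have h1 := h.hermitian u (J v)
  rw [h.gacs.1, map_neg, h.gend_pair, h.gend_pair] at h1
  rw [map_sub, LinearMap.sub_apply, h.gacs.2, ← h1]
  ring

theorem eq_zero_of_gend_eq_smul (h : IsGah G J Gend) {c : GT V} {ε : ℝ}
    (hc : Gend c = ε • c) (hcc : gpairB V c c = 0) : c = 0 := by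
  by_contra h0
  have := h.posdef c h0
  rw [h.gend_pair, hc, map_smul, LinearMap.smul_apply, hcc, smul_zero] at this
  exact lt_irrefl _ this

theorem prTc_eq_zero (h : IsGah G J Gend) (τ : GT V ≃ₗ[ℝ] GT V)
    (hτJ : ∀ u, τ (J u) = J (τ u)) (hτ : ∀ u, gpairB V (τ u) (τ u) = gpairB V u u)
    {B : GT V →ₗ[ℝ] GT V} (hB : ∀ u, τ (Gend (J u)) = B (τ u)) {μ : ℂ} {ε : ℝ}
    (hμ : μ * Complex.I = ε) {x : ℂ ⊗[ℝ] GT V} (hx : x ∈ cEigen J Complex.I ⊓ cEigen B μ)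
    (hx0 : prTc V x = 0) : x = 0 := by
  obtain ⟨h1, h2⟩ := hx
  rw [SetLike.mem_coe, mem_cEigen] at h1 h2
  refine eq_zero_of_baseChange_eq_zero (A := LinearMap.fst ℝ V (Module.Dual ℝ V))
    (B := J ∘ₗ B - ε • LinearMap.id) (fun m hm hm' => ?_) hx0 ?_
  · obtain ⟨c, rfl⟩ := τ.surjective m
    have hm1 : (τ c).1 = 0 := hm
    have hc : Gend c = (-ε : ℝ) • c := by
      apply τ.injective
      have : J (B (τ c)) = ε • τ c := by simpa [sub_eq_zero] using hm'
      rw [← hB, ← hτJ, ← h.gend_comm, h.gacs.1, map_neg, map_neg] at this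
      rw [map_smul, ← neg_inj, this]
      module
    rw [h.eq_zero_of_gend_eq_smul hc (by rw [← hτ, gpairB_apply, hm1]; simp), map_zero]
  · rw [LinearMap.baseChange_sub, LinearMap.baseChange_comp, LinearMap.sub_apply,
      LinearMap.comp_apply, h2, map_smul, h1, smul_smul, hμ, LinearMap.baseChange_smul,
      LinearMap.baseChange_id, LinearMap.smul_apply, LinearMap.id_apply, sub_eq_zero]
    exact Complex.coe_smul ε x

/-- The pairings between the vectors `e, J e, Gend (J e), J (Gend (J e))` for `e` isotropic. -/
theorem pair_frame (h : IsGah G J Gend) {e : GT V} (hee : gpairB V e e = 0) :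
    gpairB V e (J e) = 0 ∧ gpairB V e (Gend (J e)) = 0 ∧
      gpairB V e (J (Gend (J e))) = -G e e ∧ gpairB V (J e) (J e) = 0 ∧
      gpairB V (J e) (Gend (J e)) = G e e ∧ gpairB V (J e) (J (Gend (J e))) = 0 ∧
      gpairB V (Gend (J e)) (Gend (J e)) = 0 ∧
      gpairB V (Gend (J e)) (J (Gend (J e))) = 0 ∧
      gpairB V (J (Gend (J e))) (J (Gend (J e))) = 0 := by
  have hJGJ : J (Gend (J e)) = -Gend e := by rw [← h.gend_comm, h.gacs.1, map_neg]
  have h01 : gpairB V e (J e) = 0 := by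
    have := h.gacs.2 e e
    rw [gpairB_comm] at this
    linarith
  have h11 : gpairB V (J e) (J e) = 0 := by rw [h.j_j_pair, hee]
  have h12 : gpairB V (J e) (Gend (J e)) = G e e := by
    rw [gpairB_comm, ← h.gend_pair, h.hermitian]
  have h02 : gpairB V e (Gend (J e)) = 0 := by
    have h1 : G (J e) e = -G e (J e) := by
      rw [← h.hermitian, h.gacs.1, map_neg, LinearMap.neg_apply]
    rw [h.symm e] at h1
    rw [gpairB_comm, ← h.gend_pair]
    linarith
  refine ⟨h01, h02, ?_, h11, h12, ?_, ?_, ?_, ?_⟩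
  · rw [hJGJ, map_neg, gpairB_comm, ← h.gend_pair]
  · rw [h.j_j_pair, h02]
  · rw [h.gend_gend_pair, h11]
  · rw [hJGJ, map_neg, h.gend_gend_pair, gpairB_comm, h01, neg_zero]
  · rw [h.j_j_pair, h.gend_gend_pair, h11]

/-- Splitting of `W` into the span of `e, J e, Gend (J e), J (Gend (J e))` and its orthogonal
complement, for `e` isotropic. -/
theorem exists_decomp (h : IsGah G J Gend) {e : GT V} (he : e ≠ 0) (hee : gpairB V e e = 0)
    (w : GT V) : ∃ (a b c d : ℝ) (p : GT V),
      w = a • e + b • J e + c • Gend (J e) + d • J (Gend (J e)) + p ∧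
      gpairB V p e = 0 ∧ gpairB V p (J e) = 0 ∧ gpairB V p (Gend (J e)) = 0 ∧
      gpairB V p (J (Gend (J e))) = 0 := by
  have hg : G e e ≠ 0 := (h.posdef e he).ne'
  obtain ⟨h01, h02, h03, h11, h12, h13, h22, h23, h33⟩ := h.pair_frame hee
  have hc := gpairB_comm (V := V)
  refine ⟨-gpairB V w (J (Gend (J e))) / G e e, gpairB V w (Gend (J e)) / G e e,
    gpairB V w (J e) / G e e, -gpairB V w e / G e e, _, (add_sub_cancel _ w).symm, ?_, ?_, ?_, ?_⟩
  all_goals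
    simp only [map_sub, map_add, map_smul, LinearMap.sub_apply, LinearMap.add_apply,
      LinearMap.smul_apply, smul_eq_mul, hc (J e) e, hc (Gend (J e)) e, hc (J (Gend (J e))) e,
      hc (Gend (J e)) (J e), hc (J (Gend (J e))) (J e), hc (J (Gend (J e))) (Gend (J e)),
      hee, h01, h02, h03, h11, h12, h13, h22, h23, h33]
    field_simp
    ring

theorem j_perp (h : IsGah G J Gend) {e p : GT V} (h0 : gpairB V p e = 0)
    (h1 : gpairB V p (J e) = 0) (h2 : gpairB V p (Gend (J e)) = 0)
    (h3 : gpairB V p (J (Gend (J e))) = 0) :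
    gpairB V (J p) e = 0 ∧ gpairB V (J p) (J e) = 0 ∧ gpairB V (J p) (Gend (J e)) = 0 ∧
      gpairB V (J p) (J (Gend (J e))) = 0 := by
  refine ⟨?_, ?_, ?_, ?_⟩
  · rw [h.gacs.2, h1, neg_zero]
  · rw [h.j_j_pair, h0]
  · rw [h.gacs.2, h3, neg_zero]
  · rw [h.j_j_pair, h2]

end IsGah

/-- the elementary deformation preserves the ranks of the
intersections `L₁ ⊓ L₂`, `L₁ ⊓ conj(L₂)` and of their projections to `V_ℂ`. -/
theorem statement16 {V : Type*} [AddCommGroup V] [Module ℝ V] [FiniteDimensional ℝ V]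
    (G : GT V →ₗ[ℝ] GT V →ₗ[ℝ] ℝ) (J Gend : GT V →ₗ[ℝ] GT V)
    (hGah : IsGah G J Gend) (X₀ : V) (hX₀ : X₀ ≠ 0) (f : ℝ) (hf : f ≠ 0)
    (τ : GT V ≃ₗ[ℝ] GT V)
    (hτperp : ∀ w : GT V,
      (∀ s ∈ Submodule.span ℝ {((X₀, 0) : GT V), J (X₀, 0), (Gend ∘ₗ J) (X₀, 0),
          (J ∘ₗ Gend ∘ₗ J) (X₀, 0)}, gpairB V w s = 0) → τ w = w)
    (hτ0 : τ ((X₀, 0) : GT V) = f • ((X₀, 0) : GT V))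
    (hτ1 : τ (J (X₀, 0)) = f • J (X₀, 0))
    (hτ2 : τ ((Gend ∘ₗ J) (X₀, 0)) = f⁻¹ • (Gend ∘ₗ J) (X₀, 0))
    (hτ3 : τ ((J ∘ₗ Gend ∘ₗ J) (X₀, 0)) = f⁻¹ • (J ∘ₗ Gend ∘ₗ J) (X₀, 0)) :
    let J₂ : GT V →ₗ[ℝ] GT V := Gend ∘ₗ J
    let J₂' : GT V →ₗ[ℝ] GT V := τ.toLinearMap ∘ₗ J₂ ∘ₗ τ.symm.toLinearMap
    let L₁ := iEigen J
    let L₂ := iEigen J₂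
    let L₂' := iEigen J₂'
    (Module.rank ℂ ↥(L₁ ⊓ L₂') = Module.rank ℂ ↥(L₁ ⊓ L₂)) ∧
    (Module.rank ℂ ↥(L₁ ⊓ L₂'.map (conjC (GT V))) =
      Module.rank ℂ ↥(L₁ ⊓ L₂.map (conjC (GT V)))) ∧
    (Module.rank ℂ ↥((L₁ ⊓ L₂').map (prTc V)) =
      Module.rank ℂ ↥((L₁ ⊓ L₂).map (prTc V))) ∧
    (Module.rank ℂ ↥((L₁ ⊓ L₂'.map (conjC (GT V))).map (prTc V)) =
      Module.rank ℂ ↥((L₁ ⊓ L₂.map (conjC (GT V))).map (prTc V))) := by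
  intro J₂ J₂' L₁ L₂ L₂'
  simp only [LinearMap.comp_apply] at hτ2 hτ3
  set e : GT V := (X₀, 0) with he_def
  have he : e ≠ 0 := fun h0 => hX₀ (congrArg Prod.fst h0)
  have hee : gpairB V e e = 0 := by simp [gpairB_apply, he_def]
  have hperp : ∀ p : GT V, gpairB V p e = 0 → gpairB V p (J e) = 0 →
      gpairB V p (Gend (J e)) = 0 → gpairB V p (J (Gend (J e))) = 0 → τ p = p := by
    intro p h0 h1 h2 h3
    refine hτperp p fun s hs => ?_
    have hle : Submodule.span ℝ {e, J e, (Gend ∘ₗ J) e, (J ∘ₗ Gend ∘ₗ J) e}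
        ≤ LinearMap.ker (gpairB V p) := by
      rw [Submodule.span_le]
      rintro _ (rfl | rfl | rfl | rfl) <;> assumption
    exact hle hs
  have hτJ : ∀ u, τ (J u) = J (τ u) := by
    intro u
    obtain ⟨a, b, c, d, p, rfl, h0, h1, h2, h3⟩ := hGah.exists_decomp he hee u
    obtain ⟨k0, k1, k2, k3⟩ := hGah.j_perp h0 h1 h2 h3
    simp only [map_add, map_smul, map_neg, hGah.gacs.1, hτ0, hτ1, hτ2, hτ3, hperp p h0 h1 h2 h3,
      hperp (J p) k0 k1 k2 k3]
    module
  have hτpair : ∀ u, gpairB V (τ u) (τ u) = gpairB V u u := by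
    intro u
    obtain ⟨a, b, c, d, p, rfl, h0, h1, h2, h3⟩ := hGah.exists_decomp he hee u
    obtain ⟨h01, h02, h03, h11, h12, h13, h22, h23, h33⟩ := hGah.pair_frame hee
    have hc := gpairB_comm (V := V)
    simp only [map_add, map_smul, LinearMap.add_apply, LinearMap.smul_apply, smul_eq_mul,
      hτ0, hτ1, hτ2, hτ3, hperp p h0 h1 h2 h3, hc (J e) e, hc (Gend (J e)) e,
      hc (J (Gend (J e))) e, hc (Gend (J e)) (J e), hc (J (Gend (J e))) (J e),
      hc (J (Gend (J e))) (Gend (J e)), hc e p, hc (J e) p, hc (Gend (J e)) p,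
      hc (J (Gend (J e))) p, h0, h1, h2, h3, hee, h01, h02, h03, h11, h12, h13, h22, h23, h33]
    field_simp
    ring
  have hB : ∀ u, τ (J₂ u) = J₂' (τ u) := by simp [J₂']
  have hμ : Complex.I * Complex.I = ((-1 : ℝ) : ℂ) := by simp
  have hμ' : -Complex.I * Complex.I = ((1 : ℝ) : ℂ) := by simp
  have hrank := rank_cEigen_inf_cEigen τ hτJ hB Complex.I
  have hproj : ∀ {μ : ℂ} {ε : ℝ}, μ * Complex.I = ε →
      Module.rank ℂ ↥((cEigen J Complex.I ⊓ cEigen J₂' μ).map (prTc V)) =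
        Module.rank ℂ ↥((cEigen J Complex.I ⊓ cEigen J₂ μ).map (prTc V)) := by
    intro μ ε hμε
    rw [rank_map_of_forall_eq_zero (prTc V) _ fun x hx =>
        hGah.prTc_eq_zero τ hτJ hτpair hB hμε hx,
      rank_map_of_forall_eq_zero (prTc V) _ fun x hx =>
        hGah.prTc_eq_zero (LinearEquiv.refl ℝ _) (fun _ => rfl) (fun _ => rfl)
          (fun _ => rfl) hμε hx, hrank]
  have hL₂ : L₂.map (conjC (GT V)) = cEigen J₂ (-Complex.I) := map_conjC_iEigen J₂
  have hL₂' : L₂'.map (conjC (GT V)) = cEigen J₂' (-Complex.I) := map_conjC_iEigen J₂'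
  rw [hL₂, hL₂']
  exact ⟨hrank _, hrank _, hproj hμ, hproj hμ'⟩
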